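/- arXiv:0909.4717 — 3 statements merged into one kernel-verified Lean document; each statement's English description precedes it below -/
import Mathlib

section
/- With the notation above, the height of P_S(G) equals |S| + (n − c(S)), where c(S) is the number of connected components of the restriction of G to [n]∖S. -/
open MvPolynomial

/-- The binomial `f_{ab} = x_a y_b - x_b y_a` in `K[x_1,…,x_n,y_1,…,y_n]`. -/
noncomputable def edgeBinomial (K : Type*) [Field K] {n : ℕ} (a b : Fin n) :
    MvPolynomial (Fin n ⊕ Fin n) K :=
  X (Sum.inl a) * X (Sum.inr b) - X (Sum.inl b) * X (Sum.inr a)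

/-- The ideal `P_S(G)`: generated by the variables `x_i, y_i` for `i ∈ S`, together
with all binomials `x_a y_b - x_b y_a` for `a, b` lying in a common connected component
of the induced subgraph of `G` on `[n] ∖ S`. -/
noncomputable def componentPrime (K : Type*) [Field K] {n : ℕ}
    (G : SimpleGraph (Fin n)) (S : Set (Fin n)) :
    Ideal (MvPolynomial (Fin n ⊕ Fin n) K) :=
  Ideal.span ({p | ∃ i ∈ S, p = X (Sum.inl i) ∨ p = X (Sum.inr i)} ∪
    {p | ∃ a b : (Sᶜ : Set (Fin n)), (G.induce Sᶜ).Reachable a b ∧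
      p = edgeBinomial K a.1 b.1})

set_option linter.unusedSimpArgs false

section helpers

variable {K : Type*} [Field K] {n : ℕ}

open Classical in
/-- Partial parametrization: substitute those variables indexed by `T`. -/
noncomputable def subMap (K : Type*) [Field K] {n : ℕ} (S : Finset (Fin n)) (r : Fin n → Fin n)
    (T : Finset (Fin n ⊕ Fin n)) :
    MvPolynomial (Fin n ⊕ Fin n) K →ₐ[K] MvPolynomial (Fin n ⊕ Fin n) K :=
  aeval (Sum.elim
    (fun a => if a ∈ S then (if Sum.inl a ∈ T then 0 else X (Sum.inl a)) else
      if Sum.inr a ∈ T then X (Sum.inl a) * X (Sum.inl (r a)) else X (Sum.inl a))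
    (fun a => if Sum.inr a ∈ T then (if a ∈ S then 0 else X (Sum.inl a) * X (Sum.inr (r a)))
      else X (Sum.inr a)))

open Classical in
/-- The index set of the steps. -/
noncomputable def stepSet {n : ℕ} (S : Finset (Fin n)) (r : Fin n → Fin n) :
    Finset (Fin n ⊕ Fin n) :=
  S.disjSum (Finset.univ \ Finset.univ.filter (fun a => a ∉ S ∧ r a = a))

open Classical in
/-- The generator of each step. -/
noncomputable def stepGen (K : Type*) [Field K] {n : ℕ} (S : Finset (Fin n)) (r : Fin n → Fin n) :
    Fin n ⊕ Fin n → MvPolynomial (Fin n ⊕ Fin n) K :=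
  Sum.elim (fun a => X (Sum.inl a))
    (fun a => if a ∈ S then X (Sum.inr a) else edgeBinomial K (r a) a)

lemma mem_stepSet_inl (S : Finset (Fin n)) (r : Fin n → Fin n) (a : Fin n) :
    Sum.inl a ∈ stepSet S r ↔ a ∈ S := by
  simp [stepSet]

lemma mem_stepSet_inr (S : Finset (Fin n)) (r : Fin n → Fin n) (a : Fin n) :
    Sum.inr a ∈ stepSet S r ↔ (a ∉ S → r a ≠ a) := by
  simp [stepSet]

lemma edgeBinomial_ne_zero {a b : Fin n} (h : a ≠ b) : edgeBinomial K a b ≠ 0 := by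
  intro h0
  have := congrArg (MvPolynomial.eval (Sum.elim (fun i => if i = a then (1 : K) else 0)
    (fun i => if i = b then (1 : K) else 0))) h0
  simp [edgeBinomial, h] at this

lemma stepGen_ne_zero (S : Finset (Fin n)) (r : Fin n → Fin n) (t : Fin n ⊕ Fin n)
    (ht : t ∈ stepSet S r) : stepGen K S r t ≠ 0 := by
  rcases t with a | a
  · simp [stepGen]
  · rw [mem_stepSet_inr] at ht
    by_cases ha : a ∈ S
    · simp [stepGen, ha]
    · simpa [stepGen, ha] using edgeBinomial_ne_zero (ht ha)

lemma subMap_stepGen_mem (S : Finset (Fin n)) (r : Fin n → Fin n)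
    (hr : ∀ a ∉ S, r a ∉ S ∧ r (r a) = r a) (T : Finset (Fin n ⊕ Fin n))
    (hT : T ⊆ stepSet S r) (t : Fin n ⊕ Fin n) (ht : t ∈ T) :
    subMap K S r T (stepGen K S r t) = 0 := by
  rcases t with a | a
  · have := (mem_stepSet_inl S r a).1 (hT ht)
    simp [stepGen, subMap, ht, this]
  · by_cases ha : a ∈ S
    · simp [stepGen, subMap, ht, ha]
    · have h2 : Sum.inr (r a) ∉ T := fun h =>
        (mem_stepSet_inr S r _).1 (hT h) (hr a ha).1 (hr a ha).2
      simp [stepGen, subMap, ht, ha, edgeBinomial, h2, (hr a ha).1]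
      ring

lemma subMap_stepGen_notMem (S : Finset (Fin n)) (r : Fin n → Fin n)
    (hr : ∀ a ∉ S, r a ∉ S ∧ r (r a) = r a) (T : Finset (Fin n ⊕ Fin n))
    (hT : T ⊆ stepSet S r) (t : Fin n ⊕ Fin n) (ht : t ∉ T) (ht' : t ∈ stepSet S r) :
    subMap K S r T (stepGen K S r t) = stepGen K S r t := by
  rcases t with a | a
  · have := (mem_stepSet_inl S r a).1 ht'
    simp [stepGen, subMap, ht, this]
  · by_cases ha : a ∈ S
    · simp [stepGen, subMap, ht, ha]
    · have h2 : Sum.inr (r a) ∉ T := fun h =>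
        (mem_stepSet_inr S r _).1 (hT h) (hr a ha).1 (hr a ha).2
      simp [stepGen, subMap, ht, ha, edgeBinomial, h2, (hr a ha).1]

open Classical in
lemma subMap_comp (S : Finset (Fin n)) (r : Fin n → Fin n)
    (hr : ∀ a ∉ S, r a ∉ S ∧ r (r a) = r a) (T : Finset (Fin n ⊕ Fin n))
    (t : Fin n ⊕ Fin n) (ht : t ∉ T) (ht' : t ∈ stepSet S r) :
    (subMap K S r {t}).comp (subMap K S r T) = subMap K S r (insert t T) := by
  have key : ∀ a ∉ S, Sum.inr (r a) ≠ t := by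
    rintro a ha rfl
    exact (mem_stepSet_inr S r _).1 ht' (hr a ha).1 (hr a ha).2
  apply MvPolynomial.algHom_ext
  rintro (a | a)
  · by_cases ha : a ∈ S
    · by_cases h : Sum.inl a ∈ T <;> simp [subMap, ha, h]
    · by_cases h : Sum.inr a ∈ T
      · have : Sum.inr a ≠ t := by rintro rfl; exact ht h
        simp [subMap, ha, h, key a ha, (hr a ha).1, this]
      · simp [subMap, ha, h]
  · by_cases ha : a ∈ S
    · by_cases h : Sum.inr a ∈ T <;> simp [subMap, ha, h]
    · by_cases h : Sum.inr a ∈ T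
      · have : Sum.inr a ≠ t := by rintro rfl; exact ht h
        simp [subMap, ha, h, key a ha, this]
      · simp [subMap, ha, h]

lemma card_le_height_ker (S : Finset (Fin n)) (r : Fin n → Fin n)
    (hr : ∀ a ∉ S, r a ∉ S ∧ r (r a) = r a) (T : Finset (Fin n ⊕ Fin n))
    (hT : T ⊆ stepSet S r) :
    (T.card : ℕ∞) ≤ (RingHom.ker (subMap K S r T)).height := by
  classical
  induction T using Finset.induction_on with
  | empty => simp
  | insert t T ht ih =>
    have hT' : T ⊆ stepSet S r := (Finset.subset_insert _ _).trans hT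
    have htm : t ∈ stepSet S r := hT (Finset.mem_insert_self _ _)
    have hp1 : (RingHom.ker (subMap K S r T)).IsPrime := RingHom.ker_isPrime _
    have hp2 : (RingHom.ker (subMap K S r (insert t T))).IsPrime := RingHom.ker_isPrime _
    have hlt : RingHom.ker (subMap K S r T) < RingHom.ker (subMap K S r (insert t T)) := by
      refine lt_of_le_of_ne ?_ ?_
      · intro f hf
        rw [RingHom.mem_ker] at hf ⊢
        rw [← subMap_comp S r hr T t ht htm, AlgHom.comp_apply, hf, map_zero]
      · intro h
        have h1 : stepGen K S r t ∈ RingHom.ker (subMap K S r (insert t T)) :=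
          subMap_stepGen_mem S r hr _ hT t (Finset.mem_insert_self _ _)
        rw [← h, RingHom.mem_ker, subMap_stepGen_notMem S r hr T hT' t ht htm] at h1
        exact stepGen_ne_zero S r t htm h1
    rw [Finset.card_insert_of_notMem ht, Nat.cast_add, Nat.cast_one]
    exact (add_le_add_left (ih hT') 1).trans (Ideal.height_add_one_le_of_lt_of_isPrime hlt)

lemma exists_field_map.{u, v} (K : Type u) [Field K] {R : Type v} [CommRing R] [Algebra K R]
    (P : Ideal R) [P.IsPrime] :
    ∃ (F : Type v) (_ : Field F) (_ : Algebra K F) (q : R →ₐ[K] F), ∀ f, q f = 0 ↔ f ∈ P := by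
  refine ⟨FractionRing (R ⧸ P), inferInstance, inferInstance,
    (IsScalarTower.toAlgHom K (R ⧸ P) (FractionRing (R ⧸ P))).comp (Ideal.Quotient.mkₐ K P), ?_⟩
  intro f
  change algebraMap (R ⧸ P) (FractionRing (R ⧸ P)) (Ideal.Quotient.mk P f) = 0 ↔ _
  rw [FaithfulSMul.algebraMap_eq_zero_iff, Ideal.Quotient.eq_zero_iff_mem]

lemma ker_le (S : Finset (Fin n)) (r : Fin n → Fin n)
    (P : Ideal (MvPolynomial (Fin n ⊕ Fin n) K)) [P.IsPrime]
    (hr : ∀ a ∉ S, r a ∉ S ∧ r (r a) = r a)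
    (hg : ∀ t ∈ stepSet S r, stepGen K S r t ∈ P)
    (hx : ∀ a ∉ S, X (Sum.inl (r a)) ∉ P) :
    RingHom.ker (subMap K S r (stepSet S r)) ≤ P := by
  classical
  obtain ⟨F, _, _, q, hq⟩ := exists_field_map K P
  let θ : MvPolynomial (Fin n ⊕ Fin n) K →ₐ[K] F :=
    aeval (Sum.elim (fun a => if Sum.inr a ∈ stepSet S r then
      q (X (Sum.inl a)) / q (X (Sum.inl (r a))) else q (X (Sum.inl a)))
      (fun a => q (X (Sum.inr a))))
  have hcomp : θ.comp (subMap K S r (stepSet S r)) = q := by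
    apply MvPolynomial.algHom_ext
    rintro (a | a)
    · by_cases ha : a ∈ S
      · have h1 := (mem_stepSet_inl S r a).2 ha
        have := (hq _).2 (hg _ h1)
        simp only [stepGen, Sum.elim_inl] at this
        simp [subMap, ha, h1, this]
      · have h0 : q (X (Sum.inl (r a))) ≠ 0 := fun h => hx a ha ((hq _).1 h)
        have h2 : Sum.inr (r a) ∉ stepSet S r := fun h =>
          (mem_stepSet_inr S r _).1 h (hr a ha).1 (hr a ha).2
        by_cases h : Sum.inr a ∈ stepSet S r
        · simp [subMap, ha, h, θ, h2, h0]
        · simp [subMap, ha, h, θ]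
    · by_cases ha : a ∈ S
      · have h1 : Sum.inr a ∈ stepSet S r := (mem_stepSet_inr S r a).2 (fun h => absurd ha h)
        have := (hq _).2 (hg _ h1)
        simp only [stepGen, Sum.elim_inr, ha, if_true] at this
        simp [subMap, ha, h1, this]
      · have h0 : q (X (Sum.inl (r a))) ≠ 0 := fun h => hx a ha ((hq _).1 h)
        by_cases h : Sum.inr a ∈ stepSet S r
        · have := (hq _).2 (hg _ h)
          simp only [stepGen, Sum.elim_inr, ha, if_false, edgeBinomial, map_sub, map_mul] at this
          simp [subMap, ha, h, θ]
          field_simp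
          linear_combination -this
        · simp [subMap, ha, h, θ]
  intro f hf
  rw [RingHom.mem_ker] at hf
  rw [← hq, ← hcomp, AlgHom.comp_apply, hf, map_zero]

end helpers

theorem componentPrime_height (K : Type*) [Field K] {n : ℕ}
    (G : SimpleGraph (Fin n)) (S : Finset (Fin n))
    (hp : (componentPrime K G (S : Set (Fin n))).IsPrime) :
    Order.height (⟨componentPrime K G (S : Set (Fin n)), hp⟩ :
        PrimeSpectrum (MvPolynomial (Fin n ⊕ Fin n) K)) =
      (S.card + (n - Nat.card ((G.induce ((S : Set (Fin n))ᶜ)).ConnectedComponent)) : ℕ) := by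
  classical
  set H := G.induce ((S : Set (Fin n))ᶜ) with hH
  set P := componentPrime K G (S : Set (Fin n)) with hP
  let r : Fin n → Fin n := fun a =>
    if h : a ∈ ((S : Set (Fin n))ᶜ) then ((H.connectedComponentMk ⟨a, h⟩).out).1 else a
  have hout : ∀ c : H.ConnectedComponent, H.connectedComponentMk c.out = c := fun c => Quot.out_eq c
  have hrc : ∀ c : H.ConnectedComponent, r c.out.1 = c.out.1 := by
    intro c
    have : c.out.1 ∈ ((S : Set (Fin n))ᶜ) := c.out.2
    simp only [r, this, dif_pos, Subtype.coe_eta, hout]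
  have hra : ∀ a (h : a ∈ ((S : Set (Fin n))ᶜ)), r a = ((H.connectedComponentMk ⟨a, h⟩).out).1 := by
    intro a h
    simp only [r, h, dif_pos]
  have hr : ∀ a ∉ S, r a ∉ S ∧ r (r a) = r a := by
    intro a ha
    have ha' : a ∈ ((S : Set (Fin n))ᶜ) := by simpa using ha
    rw [hra a ha']
    exact ⟨fun h => ((H.connectedComponentMk ⟨a, ha'⟩).out).2 (Finset.mem_coe.2 h), hrc _⟩
  have hcard : Nat.card H.ConnectedComponent =
      (Finset.univ.filter (fun a => a ∉ S ∧ r a = a)).card := by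
    rw [← Nat.card_eq_finsetCard]
    refine Nat.card_congr (Equiv.ofBijective (fun c => ⟨c.out.1, ?_⟩) ⟨?_, ?_⟩)
    · exact Finset.mem_filter.2 ⟨Finset.mem_univ _, fun h => c.out.2 (Finset.mem_coe.2 h), hrc c⟩
    · intro c d hcd
      have : c.out = d.out := Subtype.ext (congrArg (fun z => z.1) hcd)
      rw [← hout c, ← hout d, this]
    · rintro ⟨a, ha⟩
      have ha2 : a ∉ S ∧ r a = a := by simpa using ha
      have ha' : a ∈ ((S : Set (Fin n))ᶜ) := by simpa using ha2.1
      refine ⟨H.connectedComponentMk ⟨a, ha'⟩, Subtype.ext ?_⟩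
      rw [← hra a ha']
      exact ha2.2
  have hstep : (stepSet S r).card = S.card + (n - Nat.card H.ConnectedComponent) := by
    rw [hcard, stepSet, Finset.card_disjSum, Finset.card_sdiff_of_subset (Finset.subset_univ _),
      Finset.card_univ, Fintype.card_fin]
  have hreach : ∀ a (h : a ∈ ((S : Set (Fin n))ᶜ)),
      ∃ h' : r a ∈ ((S : Set (Fin n))ᶜ), H.Reachable ⟨r a, h'⟩ ⟨a, h⟩ := by
    intro a h
    have e := hra a h
    refine ⟨by rw [e]; exact ((H.connectedComponentMk ⟨a, h⟩).out).2, ?_⟩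
    apply SimpleGraph.ConnectedComponent.exact
    simp only [e, Subtype.coe_eta, hout]
  have hg : ∀ t ∈ stepSet S r, stepGen K S r t ∈ P := by
    rintro (a | a) ht
    · exact Ideal.subset_span (Or.inl ⟨a, by simpa using (mem_stepSet_inl S r a).1 ht, Or.inl rfl⟩)
    · by_cases ha : a ∈ S
      · simp only [stepGen, Sum.elim_inr, ha, if_true]
        exact Ideal.subset_span (Or.inl ⟨a, by simpa using ha, Or.inr rfl⟩)
      · simp only [stepGen, Sum.elim_inr, ha, if_false]
        obtain ⟨h', hh⟩ := hreach a (by simpa using ha)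
        exact Ideal.subset_span (Or.inr ⟨_, _, hh, rfl⟩)
  have hx : ∀ a ∉ S, X (Sum.inl (r a)) ∉ P := by
    intro a ha hmem
    let ev := MvPolynomial.eval (Sum.elim (fun i => if i ∈ S then (0 : K) else 1)
      (fun _ : Fin n => (0 : K)))
    have hle : P ≤ RingHom.ker ev := by
      refine Ideal.span_le.2 ?_
      rintro p (⟨i, hi, rfl | rfl⟩ | ⟨b, c, -, rfl⟩)
      · have : i ∈ S := by simpa using hi
        simp [ev, this, RingHom.mem_ker]
      · simp [ev, RingHom.mem_ker]
      · simp [ev, edgeBinomial, RingHom.mem_ker]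
    have := hle hmem
    simp [ev, RingHom.mem_ker, (hr a ha).1] at this
  have hpp : P.IsPrime := hp
  rw [← hstep, ← PrimeSpectrum.height_eq_orderHeight]
  change P.height = _
  apply le_antisymm
  · have hmin : P ∈ (Ideal.span (((stepSet S r).image (stepGen K S r) : Finset _) :
        Set (MvPolynomial (Fin n ⊕ Fin n) K))).minimalPrimes := by
      refine ⟨⟨hpp, ?_⟩, ?_⟩
      · rw [Ideal.span_le]
        intro p hpm
        obtain ⟨t, ht, rfl⟩ := Finset.mem_image.1 (Finset.mem_coe.1 hpm)
        exact hg t ht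
      · rintro Q ⟨hQ, hJ⟩ hQP
        have hgQ : ∀ t ∈ stepSet S r, stepGen K S r t ∈ Q := fun t ht =>
          hJ (Ideal.subset_span (Finset.mem_coe.2 (Finset.mem_image_of_mem _ ht)))
        have hfQ : ∀ a ∉ S, edgeBinomial K (r a) a ∈ Q := by
          intro a ha
          by_cases h : r a = a
          · rw [h]; simp [edgeBinomial]
          · have := hgQ (Sum.inr a) ((mem_stepSet_inr S r a).2 fun _ => h)
            simpa [stepGen, ha] using this
        refine Ideal.span_le.2 ?_
        rintro p (⟨i, hi, rfl | rfl⟩ | ⟨b, c, hbc, rfl⟩)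
        · exact hgQ (Sum.inl i) ((mem_stepSet_inl S r i).2 (by simpa using hi))
        · have hi' : i ∈ S := by simpa using hi
          have := hgQ (Sum.inr i) ((mem_stepSet_inr S r i).2 (fun h => absurd hi' h))
          simpa [stepGen, hi'] using this
        · have hb : b.1 ∉ S := fun h => b.2 (Finset.mem_coe.2 h)
          have hc : c.1 ∉ S := fun h => c.2 (Finset.mem_coe.2 h)
          have hrbc : r b.1 = r c.1 := by
            rw [hra b.1 b.2, hra c.1 c.2]
            have : H.connectedComponentMk b = H.connectedComponentMk c :=
              SimpleGraph.ConnectedComponent.sound hbc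
            simp only [Subtype.coe_eta, this]
          have h1 := hfQ b.1 hb
          have h2 := hfQ c.1 hc
          rw [← hrbc] at h2
          have h3 : X (Sum.inl (r b.1)) * edgeBinomial K b.1 c.1 ∈ Q := by
            have : X (Sum.inl (r b.1)) * edgeBinomial K b.1 c.1 =
              X (Sum.inl b.1) * edgeBinomial K (r b.1) c.1 -
                X (Sum.inl c.1) * edgeBinomial K (r b.1) b.1 := by
              simp only [edgeBinomial]; ring
            rw [this]
            exact Q.sub_mem (Q.mul_mem_left _ h2) (Q.mul_mem_left _ h1)
          exact (hQ.mem_or_mem h3).resolve_left fun h => hx b.1 hb (hQP h)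
    refine (Ideal.height_le_card_of_mem_minimalPrimes_span_finset hmin).trans ?_
    exact_mod_cast Finset.card_image_le
  · exact (card_le_height_ker S r hr _ subset_rfl).trans (Ideal.height_mono (ker_le S r P hr hg hx))
end

section
/- Let G be a simple graph on [n]. Then dim S/J_G = max{ (n − |S|) + c(S) : S ⊆ [n] }, where c(S) is the number of connected components of the induced subgraph of G on [n]∖S. In particular dim S/J_G ≥ n + c, where c is the number of connected components of G. -/
open MvPolynomial

/-- The binomial edge ideal `J_G` of a simple graph `G` on `[n]`. -/
noncomputable def binomialEdgeIdeal (K : Type*) [Field K] {n : ℕ}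
    (G : SimpleGraph (Fin n)) : Ideal (MvPolynomial (Fin n ⊕ Fin n) K) :=
  Ideal.span {p | ∃ i j : Fin n, G.Adj i j ∧ i < j ∧ p = edgeBinomial K i j}

/-- `c(S)`: the number of connected components of the induced subgraph of `G`
on `[n] ∖ S`. -/
noncomputable def numComponents {n : ℕ} (G : SimpleGraph (Fin n))
    (S : Finset (Fin n)) : ℕ :=
  Nat.card ((G.induce ((S : Set (Fin n))ᶜ)).ConnectedComponent)

lemma bei_krullDim_of_integral {A B : Type*} [CommRing A] [CommRing B] [Algebra A B]
    [Algebra.IsIntegral A B] [FaithfulSMul A B] : ringKrullDim B = ringKrullDim A := by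
  apply le_antisymm
  · refine Order.krullDim_le_of_strictMono (PrimeSpectrum.comap (algebraMap A B)) ?_
    intro p q h
    exact Ideal.IsIntegral.comap_lt_comap (R := A) (I := p.asIdeal) (J := q.asIdeal) h
  · refine iSup_le fun l => ?_
    obtain ⟨⟨P, hP, hP'⟩⟩ := Ideal.nonempty_primesOver (R := A) (S := B) l.head.asIdeal
    obtain ⟨L, hL, -⟩ := Ideal.exists_ltSeries_of_hasGoingUp l P
    rw [← hL]
    exact le_iSup (fun l : LTSeries (PrimeSpectrum B) => ((l.length : ℕ∞) : WithBot ℕ∞)) L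

lemma bei_noether (K R : Type*) [Field K] [CommRing R] [Nontrivial R] [Algebra K R]
    [Algebra.FiniteType K R] : ∃ s : ℕ, ringKrullDim R = s ∧
      (∃ P : Ideal R, P.IsPrime ∧ (s : Cardinal) ≤ Algebra.trdeg K (R ⧸ P)) ∧
      (IsDomain R → Algebra.trdeg K R ≤ (s : Cardinal)) := by
  obtain ⟨s, g, hg, hi⟩ := exists_integral_inj_algHom_of_fg K R
  refine ⟨s, ?_, ?_, ?_⟩
  · let := g.toRingHom.toAlgebra
    have : Algebra.IsIntegral (MvPolynomial (Fin s) K) R := ⟨hi⟩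
    have : FaithfulSMul (MvPolynomial (Fin s) K) R :=
      (faithfulSMul_iff_algebraMap_injective _ _).2 hg
    rw [bei_krullDim_of_integral (A := MvPolynomial (Fin s) K) (B := R)]
    simp
  · have : ∃ P : Ideal R, P.IsPrime ∧ P.comap g.toRingHom = ⊥ := by
      let := g.toRingHom.toAlgebra
      have : Algebra.IsIntegral (MvPolynomial (Fin s) K) R := ⟨hi⟩
      have : FaithfulSMul (MvPolynomial (Fin s) K) R :=
        (faithfulSMul_iff_algebraMap_injective _ _).2 hg
      obtain ⟨⟨P, hP, hP'⟩⟩ := Ideal.nonempty_primesOver (R := MvPolynomial (Fin s) K) (S := R) ⊥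
      exact ⟨P, hP, hP'.over.symm⟩
    obtain ⟨P, hP, h⟩ := this
    refine ⟨P, hP, ?_⟩
    have hinj : Function.Injective ((Ideal.Quotient.mkₐ K P).comp g) := by
      rw [injective_iff_map_eq_zero]
      intro a ha
      have : a ∈ P.comap g.toRingHom := by
        rw [Ideal.mem_comap]
        exact Ideal.Quotient.eq_zero_iff_mem.1 ha
      rwa [h] at this
    have := ((MvPolynomial.algebraicIndependent_X (Fin s) K).map' hinj).lift_cardinalMk_le_trdeg
    simpa using this
  · intro hD
    let t : Set R := Set.range (fun i => g (X i))
    have hr : ∀ p, g p ∈ Algebra.adjoin K t := by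
      intro p
      have h1 : g = MvPolynomial.aeval (fun i => g (X i)) := by ext; simp
      rw [Algebra.adjoin_range_eq_range_aeval, ← h1]
      exact ⟨p, rfl⟩
    have : Algebra.IsAlgebraic (Algebra.adjoin K t) R := by
      constructor
      intro x
      apply IsIntegral.isAlgebraic
      obtain ⟨q, hq, hq'⟩ := hi x
      refine ⟨q.map (g.codRestrict (Algebra.adjoin K t) hr).toRingHom, hq.map _, ?_⟩
      rw [Polynomial.eval₂_map]
      exact hq'
    refine (Algebra.IsAlgebraic.trdeg_le_cardinalMk K t).trans ?_
    have := Cardinal.mk_range_le_lift (f := fun i => g (X i))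
    simpa using this

lemma bei_card {n : ℕ} (G : SimpleGraph (Fin n)) (S : Finset (Fin n)) :
    Nat.card (↥((S : Set (Fin n))ᶜ) ⊕ (G.induce ((S : Set (Fin n))ᶜ)).ConnectedComponent) =
      (n - S.card) + numComponents G S := by
  have : Finite (G.induce ((S : Set (Fin n))ᶜ)).ConnectedComponent := Quot.finite _
  rw [Nat.card_sum]
  congr 1
  rw [← Finset.coe_compl, Nat.card_coe_set_eq, Set.ncard_coe_finset, Finset.card_compl]
  simp

lemma bei_upper {K : Type*} [Field K] {n : ℕ} (G : SimpleGraph (Fin n)) {D : Type*} [CommRing D]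
    [IsDomain D] [Algebra K D] (φ : MvPolynomial (Fin n ⊕ Fin n) K →ₐ[K] D)
    (hφ : Function.Surjective φ) (hJ : ∀ p ∈ binomialEdgeIdeal K G, φ p = 0) :
    ∃ S : Finset (Fin n), Algebra.trdeg K D ≤ (((n - S.card) + numComponents G S : ℕ) : Cardinal) := by
  classical
  let x : Fin n → D := fun i => φ (X (Sum.inl i))
  let y : Fin n → D := fun i => φ (X (Sum.inr i))
  let S : Finset (Fin n) := Finset.univ.filter (fun i => x i = 0 ∧ y i = 0)
  have hS : ∀ i, i ∈ (S : Set (Fin n))ᶜ ↔ ¬ (x i = 0 ∧ y i = 0) := by intro i; simp [S]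
  have hadj : ∀ i j, G.Adj i j → x i * y j = x j * y i := by
    have key : ∀ i j, G.Adj i j → i < j → x i * y j = x j * y i := by
      intro i j h hij
      have := hJ _ (Ideal.subset_span ⟨i, j, h, hij, rfl⟩)
      simpa [edgeBinomial, sub_eq_zero] using this
    intro i j h
    rcases lt_or_gt_of_ne h.ne with h' | h'
    · exact key i j h h'
    · exact (key j i h.symm h').symm
  let H := G.induce ((S : Set (Fin n))ᶜ)
  have hreach : ∀ a b, H.Reachable a b → x a * y b = x b * y a := by
    rintro a b ⟨w⟩
    induction w with
    | nil => rfl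
    | @cons u v w h p ih =>
      have h1 : x u * y v = x v * y u := hadj _ _ h
      by_cases hv : x v = 0
      · have hy : y v ≠ 0 := fun h => (hS v).1 v.2 ⟨hv, h⟩
        have e1 : x u = 0 := by simpa [hv, hy] using h1
        have e2 : x w = 0 := by simpa [hv, hy] using ih
        simp [e1, e2]
      · apply mul_left_cancel₀ hv
        linear_combination x u * ih + x w * h1
  let f : (↥((S : Set (Fin n))ᶜ) ⊕ H.ConnectedComponent) → D :=
    Sum.elim (fun i => if x i = 0 then y i else x i) (fun C => y C.out)
  have hmem : ∀ z, f z ∈ Algebra.adjoin K (Set.range f) := fun z =>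
    Algebra.subset_adjoin ⟨z, rfl⟩
  have halg : ∀ d ∈ Algebra.adjoin K (Set.range f), IsAlgebraic (Algebra.adjoin K (Set.range f)) d :=
    fun d hd => isAlgebraic_algebraMap (⟨d, hd⟩ : Algebra.adjoin K (Set.range f))
  have hx : ∀ i, x i ∈ Algebra.adjoin K (Set.range f) := by
    intro i
    by_cases h : x i = 0
    · rw [h]; exact zero_mem _
    · have := hmem (Sum.inl ⟨i, (hS i).2 fun h' => h h'.1⟩)
      simpa [f, h] using this
  have hy : ∀ i, IsAlgebraic (Algebra.adjoin K (Set.range f)) (y i) := by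
    intro i
    by_cases hi : x i = 0 ∧ y i = 0
    · rw [hi.2]; exact isAlgebraic_zero
    by_cases h : x i = 0
    · have := hmem (Sum.inl ⟨i, (hS i).2 hi⟩)
      apply halg
      simpa [f, h] using this
    · let a : ↥((S : Set (Fin n))ᶜ) := ⟨i, (hS i).2 hi⟩
      let r := (H.connectedComponentMk a).out
      have hr : H.Reachable r a := by
        rw [← SimpleGraph.ConnectedComponent.eq]
        exact Quot.out_eq _
      have e : x r * y i = x i * y r := hreach r a hr
      have hxr : x r ≠ 0 := by
        intro h0
        have : y r = 0 := by simpa [h0, h] using e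
        exact (hS r).1 r.2 ⟨h0, this⟩
      have hyr : y r ∈ Algebra.adjoin K (Set.range f) := hmem (Sum.inr (H.connectedComponentMk a))
      have h1 := halg _ (mul_mem (hx i) hyr)
      rw [← e] at h1
      refine IsAlgebraic.of_mul (mem_nonZeroDivisors_of_ne_zero hxr) (halg _ (hx _)) ?_
      first | exact h1 | (rw [mul_comm]; exact h1)
  have : Algebra.IsAlgebraic (Algebra.adjoin K (Set.range f)) D := by
    constructor
    intro d
    obtain ⟨p, rfl⟩ := hφ d
    induction p using MvPolynomial.induction_on with
    | C a =>
      apply halg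
      have : φ (C a) = algebraMap K D a := φ.commutes a
      rw [this]
      exact Subalgebra.algebraMap_mem _ _
    | add p q hp hq => rw [map_add]; exact hp.add hq
    | mul_X p i hp =>
      rw [map_mul]
      refine hp.mul ?_
      rcases i with i | i
      · exact halg _ (hx i)
      · exact hy i
  refine ⟨S, (Algebra.IsAlgebraic.trdeg_le_cardinalMk K (Set.range f)).trans ?_⟩
  have h1 := Cardinal.mk_range_le_lift (f := f)
  have h2 : Nat.card (↥((S : Set (Fin n))ᶜ) ⊕ H.ConnectedComponent) =
      (n - S.card) + numComponents G S := bei_card G S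
  rw [← h2]
  have : Finite H.ConnectedComponent := Quot.finite _
  rw [← Nat.cast_card (α := ↥((S : Set (Fin n))ᶜ) ⊕ H.ConnectedComponent)] at h1
  simpa using h1

lemma bei_lower {K : Type*} [Field K] {n : ℕ} (G : SimpleGraph (Fin n)) (S : Finset (Fin n)) :
    Nontrivial (MvPolynomial (Fin n ⊕ Fin n) K ⧸ binomialEdgeIdeal K G) ∧
    (((n - S.card) + numComponents G S : ℕ) : WithBot ℕ∞) ≤
      ringKrullDim (MvPolynomial (Fin n ⊕ Fin n) K ⧸ binomialEdgeIdeal K G) := by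
  classical
  let H := G.induce ((S : Set (Fin n))ᶜ)
  let I := ↥((S : Set (Fin n))ᶜ) ⊕ H.ConnectedComponent
  let L := FractionRing (MvPolynomial I K)
  let v : I → L := fun i => algebraMap (MvPolynomial I K) L (X i)
  have hv : ∀ i, v i ≠ 0 := by
    intro i
    simp [v, L]
  have hvI : AlgebraicIndependent K v := by
    have := (MvPolynomial.algebraicIndependent_X I K).map'
      (f := IsScalarTower.toAlgHom K (MvPolynomial I K) L) (IsFractionRing.injective _ _)
    exact this
  let mx : Fin n → L := fun i => if h : i ∈ (S : Set (Fin n))ᶜ then v (Sum.inl ⟨i, h⟩) else 0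
  let my : Fin n → L := fun i => if h : i ∈ (S : Set (Fin n))ᶜ then
    v (Sum.inl ⟨i, h⟩) * v (Sum.inr (H.connectedComponentMk ⟨i, h⟩)) /
      v (Sum.inl (H.connectedComponentMk ⟨i, h⟩).out) else 0
  let Φ : MvPolynomial (Fin n ⊕ Fin n) K →ₐ[K] L := MvPolynomial.aeval (Sum.elim mx my)
  have hΦ : ∀ p ∈ binomialEdgeIdeal K G, Φ p = 0 := by
    intro p hp
    have : binomialEdgeIdeal K G ≤ RingHom.ker Φ := by
      refine Ideal.span_le.2 ?_
      rintro _ ⟨i, j, hij, -, rfl⟩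
      change Φ _ = 0
      have : mx i * my j - mx j * my i = 0 := by
        by_cases hi : i ∈ (S : Set (Fin n))ᶜ
        · by_cases hj : j ∈ (S : Set (Fin n))ᶜ
          · have hc : H.connectedComponentMk ⟨i, hi⟩ = H.connectedComponentMk ⟨j, hj⟩ := by
              apply SimpleGraph.ConnectedComponent.sound
              apply SimpleGraph.Adj.reachable
              exact hij
            simp only [mx, my, dif_pos hi, dif_pos hj, hc]
            ring
          · simp only [mx, my, dif_pos hi, dif_neg hj]; ring
        · simp only [mx, my, dif_neg hi]; ring
      simpa [Φ, edgeBinomial] using this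
    exact this hp
  let Ψ := Ideal.Quotient.liftₐ (binomialEdgeIdeal K G) Φ hΦ
  have hnt : Nontrivial (MvPolynomial (Fin n ⊕ Fin n) K ⧸ binomialEdgeIdeal K G) :=
    Ψ.toRingHom.domain_nontrivial
  refine ⟨hnt, ?_⟩
  have hΨ : ∀ p, Φ p ∈ Ψ.range := fun p => ⟨Ideal.Quotient.mk _ p, rfl⟩
  have hvm : ∀ i, v i ∈ Ψ.range := by
    rintro (i | C)
    · have := hΨ (X (Sum.inl i.1))
      have e : Φ (X (Sum.inl i.1)) = v (Sum.inl i) := by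
        have : mx i.1 = v (Sum.inl i) := dif_pos i.2
        simpa [Φ] using this
      rwa [e] at this
    · have := hΨ (X (Sum.inr C.out.1))
      have e : Φ (X (Sum.inr C.out.1)) = v (Sum.inr C) := by
        have h1 : H.connectedComponentMk C.out = C := Quot.out_eq _
        have : my C.out.1 = v (Sum.inr C) := by
          refine (dif_pos C.out.2).trans ?_
          simp only [Subtype.coe_eta, h1]
          rw [mul_div_assoc, mul_div_cancel₀]
          exact hv _
        simpa [Φ] using this
      rwa [e] at this
  have hsurj := Ψ.rangeRestrict_surjective
  have : Algebra.FiniteType K Ψ.range := Algebra.FiniteType.of_surjective Ψ.rangeRestrict hsurj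
  refine le_trans ?_ (ringKrullDim_le_of_surjective Ψ.rangeRestrict.toRingHom hsurj)
  obtain ⟨s, hs, -, h⟩ := bei_noether K Ψ.range
  have h := h inferInstance
  have hvI' : AlgebraicIndependent K (fun i => (⟨v i, hvm i⟩ : Ψ.range)) :=
    AlgebraicIndependent.of_comp Ψ.range.val hvI
  have h1 := hvI'.lift_cardinalMk_le_trdeg
  have h2 : Nat.card I = (n - S.card) + numComponents G S := bei_card G S
  rw [hs, ← h2]
  have : Finite H.ConnectedComponent := Quot.finite _
  have : Finite I := inferInstanceAs (Finite (_ ⊕ _))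
  rw [← Nat.cast_card] at h1
  have h3 := h1.trans (Cardinal.lift_le.2 h)
  simp only [Cardinal.lift_natCast, Nat.cast_le] at h3
  exact_mod_cast h3

/-- `dim S/J_G = max { (n - |S|) + c(S) : S ⊆ [n] }`; in particular
`dim S/J_G ≥ n + c` where `c` is the number of connected components of `G`. -/
theorem krullDim_quotient_binomialEdgeIdeal (K : Type*) [Field K] {n : ℕ}
    (G : SimpleGraph (Fin n)) :
    (ringKrullDim (MvPolynomial (Fin n ⊕ Fin n) K ⧸ binomialEdgeIdeal K G) =
        ⨆ S : Finset (Fin n), (((n - S.card) + numComponents G S : ℕ) : WithBot ℕ∞)) ∧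
      ((n + Nat.card G.ConnectedComponent : ℕ) : WithBot ℕ∞) ≤
        ringKrullDim (MvPolynomial (Fin n ⊕ Fin n) K ⧸ binomialEdgeIdeal K G) := by
  have := (bei_lower (K := K) G ∅).1
  refine ⟨le_antisymm ?_ (iSup_le fun S => (bei_lower G S).2), ?_⟩
  · obtain ⟨s, hs, ⟨P, hP, hsP⟩, -⟩ :=
      bei_noether K (MvPolynomial (Fin n ⊕ Fin n) K ⧸ binomialEdgeIdeal K G)
    obtain ⟨S, hS⟩ := bei_upper G
      ((Ideal.Quotient.mkₐ K P).comp (Ideal.Quotient.mkₐ K (binomialEdgeIdeal K G)))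
      ((Ideal.Quotient.mkₐ_surjective K P).comp (Ideal.Quotient.mkₐ_surjective K _))
      (fun p hp => by
        have : Ideal.Quotient.mkₐ K (binomialEdgeIdeal K G) p = 0 :=
          Ideal.Quotient.eq_zero_iff_mem.2 hp
        rw [AlgHom.comp_apply, this, map_zero])
    rw [hs]
    refine le_trans ?_ (le_iSup _ S)
    have := hsP.trans hS
    rw [Nat.cast_le] at this
    exact_mod_cast this
  · have h := (bei_lower (K := K) G ∅).2
    have e : numComponents G ∅ = Nat.card G.ConnectedComponent := by
      unfold numComponents
      rw [Finset.coe_empty, Set.compl_empty]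
      exact Nat.card_congr (SimpleGraph.induceUnivIso G).connectedComponentEquiv
    rw [e] at h
    simpa using h
end

section
/- Let G be the cycle of length n ≥ 4, labeled counterclockwise. For every nonempty S ⊆ [n], writing S as a disjoint union of intervals, the number c(S) of connected components of the induced subgraph on [n]∖S satisfies (n − |S|) + c(S) ≤ n, while (n − |∅|) + c(∅) = n + 1. Consequently J_G is not unmixed for n ≥ 4. -/
open MvPolynomial

/-- An ideal is *unmixed* if all its minimal primes cut out quotients of the same
dimension (equivalently, all minimal primes have the same height). -/
def IsUnmixed {R : Type*} [CommRing R] (I : Ideal R) : Prop :=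
  ∀ P ∈ I.minimalPrimes, ∀ Q ∈ I.minimalPrimes,
    ringKrullDim (R ⧸ P) = ringKrullDim (R ⧸ Q)

theorem aux_dim_le_trdeg {K D : Type*} [Field K] [CommRing D] [IsDomain D] [Algebra K D]
    [Algebra.FiniteType K D] (T : Finset D)
    (hT : Algebra.IsAlgebraic (Algebra.adjoin K (T : Set D)) D) :
    ringKrullDim D ≤ T.card := by
  obtain ⟨s, g, hg, hint⟩ := exists_integral_inj_algHom_of_fg K D
  have h1 : (Algebra.trdeg K D) ≤ T.card := by
    have := Algebra.IsAlgebraic.trdeg_le_cardinalMk K (T : Set D)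
    simpa using this
  have h2 := MvPolynomial.algebraicIndependent_X (Fin s) K
  have h3 := (h2.map' hg).lift_cardinalMk_le_trdeg
  have h4 : s ≤ T.card := by
    simp only [Cardinal.mk_fin, Cardinal.lift_natCast] at h3
    have h5 : Cardinal.lift.{0} (Algebra.trdeg K D) ≤ T.card := by simpa using h1
    exact_mod_cast h3.trans h5
  have h6 : ringKrullDim D ≤ ringKrullDim (MvPolynomial (Fin s) K) := by
    algebraize [g.toRingHom]
    refine Order.krullDim_le_of_strictMono
      (fun I ↦ ⟨Ideal.comap (algebraMap (MvPolynomial (Fin s) K) D) I.asIdeal, inferInstance⟩) ?_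
    intro I J hIJ
    exact Ideal.IsIntegral.comap_lt_comap (R := MvPolynomial (Fin s) K)
      (I := I.asIdeal) (J := J.asIdeal) hIJ
  refine h6.trans ?_
  rw [MvPolynomial.ringKrullDim_of_isNoetherianRing, ringKrullDim_eq_zero_of_field]
  simp only [Nat.card_eq_fintype_card, Fintype.card_fin, zero_add]
  exact_mod_cast h4

theorem aux_step {K D : Type*} [Field K] [CommRing D] [IsDomain D] [Algebra K D]
    (T T' : Finset D) (h : T ⊆ T') (z : D)
    (hz : IsAlgebraic (Algebra.adjoin K (T : Set D)) z) :
    IsAlgebraic (Algebra.adjoin K (T' : Set D)) z := by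
  have hle : Algebra.adjoin K (T : Set D) ≤ Algebra.adjoin K (T' : Set D) :=
    Algebra.adjoin_mono (by exact_mod_cast h)
  obtain ⟨p, hp, hpz⟩ := hz
  refine ⟨p.map (Subalgebra.inclusion hle).toRingHom, ?_, ?_⟩
  · rwa [Ne, Polynomial.map_eq_zero_iff]
    exact Subalgebra.inclusion_injective hle
  · rw [Polynomial.aeval_def, Polynomial.eval₂_map]
    exact hpz

theorem aux_mem {K D : Type*} [Field K] [CommRing D] [IsDomain D] [Algebra K D]
    (T : Finset D) (z : D) (hz : z ∈ T) :
    IsAlgebraic (Algebra.adjoin K (T : Set D)) z :=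
  isAlgebraic_algebraMap (⟨z, Algebra.subset_adjoin (by exact_mod_cast hz)⟩ :
    Algebra.adjoin K (T : Set D))

theorem aux_seq {K D : Type*} [Field K] [CommRing D] [IsDomain D] [Algebra K D]
    (a b : ℕ → D) (ha : a 0 = 0) (hb : b 0 = 0)
    (h : ∀ k, a k * b (k + 1) = a (k + 1) * b k) (k : ℕ) :
    ∃ T : Finset D, T.card ≤ k + 1 ∧ (a k = 0 → b k = 0 → T.card ≤ k) ∧
      ∀ j ≤ k, IsAlgebraic (Algebra.adjoin K (T : Set D)) (a j) ∧
        IsAlgebraic (Algebra.adjoin K (T : Set D)) (b j) := by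
  classical
  induction k with
  | zero =>
    refine ⟨∅, by simp, by simp, ?_⟩
    intro j hj
    obtain rfl : j = 0 := by omega
    rw [ha, hb]
    exact ⟨isAlgebraic_zero, isAlgebraic_zero⟩
  | succ k ih =>
    obtain ⟨T, h1, h2, h3⟩ := ih
    by_cases hz : a (k+1) = 0 ∧ b (k+1) = 0
    · refine ⟨T, by omega, fun _ _ => h1, ?_⟩
      intro j hj
      rcases Nat.lt_or_ge k j with hj' | hj'
      · obtain rfl : j = k + 1 := by omega
        rw [hz.1, hz.2]
        exact ⟨isAlgebraic_zero, isAlgebraic_zero⟩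
      · exact h3 j hj'
    · by_cases hak : a k = 0
      · by_cases hbk : b k = 0
        · have := h2 hak hbk
          have hc : (insert (a (k+1)) (insert (b (k+1)) T)).card ≤ k + 1 + 1 :=
            (Finset.card_insert_le _ _).trans
              (Nat.succ_le_succ ((Finset.card_insert_le _ _).trans (Nat.succ_le_succ this)))
          refine ⟨insert (a (k+1)) (insert (b (k+1)) T), hc, fun x y => absurd ⟨x, y⟩ hz, ?_⟩
          intro j hj
          rcases Nat.lt_or_ge k j with hj' | hj'
          · obtain rfl : j = k + 1 := by omega
            exact ⟨aux_mem _ _ (by simp), aux_mem _ _ (by simp)⟩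
          · have hs : T ⊆ insert (a (k+1)) (insert (b (k+1)) T) := by
              intro z hz; simp [hz]
            exact ⟨aux_step _ _ hs _ (h3 j hj').1, aux_step _ _ hs _ (h3 j hj').2⟩
        · have hs : T ⊆ insert (b (k+1)) T := Finset.subset_insert _ _
          refine ⟨insert (b (k+1)) T, (Finset.card_insert_le _ _).trans (Nat.succ_le_succ h1),
            fun x y => absurd ⟨x, y⟩ hz, ?_⟩
          intro j hj
          rcases Nat.lt_or_ge k j with hj' | hj'
          · obtain rfl : j = k + 1 := by omega
            have hm : IsAlgebraic (Algebra.adjoin K ((insert (b (k+1)) T : Finset D) : Set D))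
              (b (k+1)) := aux_mem _ _ (by simp)
            refine ⟨?_, hm⟩
            refine IsAlgebraic.of_mul (y := b k) (mem_nonZeroDivisors_of_ne_zero hbk)
              (aux_step _ _ hs _ (h3 k le_rfl).2) ?_
            rw [mul_comm, ← h k]
            exact (aux_step _ _ hs _ (h3 k le_rfl).1).mul hm
          · exact ⟨aux_step _ _ hs _ (h3 j hj').1, aux_step _ _ hs _ (h3 j hj').2⟩
      · have hs : T ⊆ insert (a (k+1)) T := Finset.subset_insert _ _
        refine ⟨insert (a (k+1)) T, (Finset.card_insert_le _ _).trans (Nat.succ_le_succ h1),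
          fun x y => absurd ⟨x, y⟩ hz, ?_⟩
        intro j hj
        rcases Nat.lt_or_ge k j with hj' | hj'
        · obtain rfl : j = k + 1 := by omega
          have hm : IsAlgebraic (Algebra.adjoin K ((insert (a (k+1)) T : Finset D) : Set D))
            (a (k+1)) := aux_mem _ _ (by simp)
          refine ⟨hm, ?_⟩
          refine IsAlgebraic.of_mul (y := a k) (mem_nonZeroDivisors_of_ne_zero hak)
            (aux_step _ _ hs _ (h3 k le_rfl).1) ?_
          rw [h k]
          exact hm.mul (aux_step _ _ hs _ (h3 k le_rfl).2)
        · exact ⟨aux_step _ _ hs _ (h3 j hj').1, aux_step _ _ hs _ (h3 j hj').2⟩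

theorem aux_mem_J (K : Type*) [Field K] {n : ℕ} (G : SimpleGraph (Fin n)) (i j : Fin n)
    (h : G.Adj i j) : edgeBinomial K i j ∈ binomialEdgeIdeal K G := by
  rcases lt_trichotomy i j with hl | rfl | hl
  · exact Ideal.subset_span ⟨i, j, h, hl, rfl⟩
  · exact absurd h (G.loopless.irrefl _)
  · have : edgeBinomial K i j = - edgeBinomial K j i := by
      unfold edgeBinomial; ring
    rw [this, neg_mem_iff]
    exact Ideal.subset_span ⟨j, i, h.symm, hl, rfl⟩

theorem aux_adj {m : ℕ} (i : Fin (m+4)) : (SimpleGraph.cycleGraph (m+4)).Adj i (i+1) := by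
  rw [SimpleGraph.cycleGraph_adj]; right; simp

theorem aux_upper (K : Type*) [Field K] {m : ℕ}
    (P : Ideal (MvPolynomial (Fin (m+4) ⊕ Fin (m+4)) K)) [P.IsPrime]
    (hP : binomialEdgeIdeal K (SimpleGraph.cycleGraph (m+4)) ≤ P) (i : Fin (m+4))
    (hx : X (Sum.inl i) ∈ P) (hy : X (Sum.inr i) ∈ P) :
    ringKrullDim (MvPolynomial (Fin (m+4) ⊕ Fin (m+4)) K ⧸ P) ≤ ((m+4 : ℕ) : WithBot ℕ∞) := by
  let q := Ideal.Quotient.mkₐ K P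
  obtain ⟨T, hT1, -, hT⟩ := aux_seq (K := K)
    (fun k : ℕ => q (X (Sum.inl (i + Fin.ofNat (m+4) k))))
    (fun k : ℕ => q (X (Sum.inr (i + Fin.ofNat (m+4) k))))
    (by simpa [q, Ideal.Quotient.eq_zero_iff_mem] using hx)
    (by simpa [q, Ideal.Quotient.eq_zero_iff_mem] using hy)
    (by
      intro k
      have e : i + Fin.ofNat (m+4) (k+1) = (i + Fin.ofNat (m+4) k) + 1 := by
        rw [add_assoc]; congr 1
        ext; simp [Fin.val_add]
      have := hP (aux_mem_J K _ _ _ (aux_adj (i + Fin.ofNat (m+4) k)))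
      rw [← Ideal.Quotient.eq_zero_iff_mem, edgeBinomial, map_sub, map_mul, map_mul,
        sub_eq_zero] at this
      simp only [e]
      exact this)
    (m+3)
  have key : ∀ j, IsAlgebraic (Algebra.adjoin K (SetLike.coe T)) (q (X (Sum.inl j))) ∧
      IsAlgebraic (Algebra.adjoin K (SetLike.coe T)) (q (X (Sum.inr j))) := by
    intro j
    have := hT (j - i).val (by omega)
    simpa using this
  refine (aux_dim_le_trdeg (K := K) T ⟨?_⟩).trans (by exact_mod_cast hT1)
  intro z
  obtain ⟨p, rfl⟩ := Ideal.Quotient.mk_surjective z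
  change IsAlgebraic _ (q p)
  induction p using MvPolynomial.induction_on with
  | C c =>
    have : q (C c) = algebraMap K _ c := q.commutes c
    rw [this]
    exact isAlgebraic_algebraMap (algebraMap K (Algebra.adjoin K (SetLike.coe T)) c)
  | add p q' hp hq => rw [map_add]; exact hp.add hq
  | mul_X p j hp =>
    rw [map_mul]
    refine hp.mul ?_
    rcases j with j | j
    · exact (key j).1
    · exact (key j).2

theorem aux_lower (K : Type*) [Field K] {n : ℕ} (hn : 0 < n) (G : SimpleGraph (Fin n)) :
    ∃ P ∈ (binomialEdgeIdeal K G).minimalPrimes,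
      ((n + 1 : ℕ) : WithBot ℕ∞) ≤ ringKrullDim (MvPolynomial (Fin n ⊕ Fin n) K ⧸ P) := by
  let φ : MvPolynomial (Fin n ⊕ Fin n) K →ₐ[K] Polynomial (MvPolynomial (Fin n) K) :=
    aeval (Sum.elim (fun i => Polynomial.C (X i)) (fun i => Polynomial.C (X i) * Polynomial.X))
  have hker : binomialEdgeIdeal K G ≤ RingHom.ker φ := by
    refine Ideal.span_le.2 ?_
    rintro p ⟨i, j, -, -, rfl⟩
    simp only [SetLike.mem_coe, RingHom.mem_ker, edgeBinomial, φ, map_sub, map_mul, aeval_X,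
      Sum.elim_inl, Sum.elim_inr]
    ring
  have : (RingHom.ker φ).IsPrime := RingHom.ker_isPrime _
  obtain ⟨P, hP, hPle⟩ := Ideal.exists_minimalPrimes_le hker
  refine ⟨P, hP, ?_⟩
  have hPp : P.IsPrime := hP.1.1
  let ψ : MvPolynomial (Fin n ⊕ Fin n) K →+* MvPolynomial (Fin n) K :=
    (Polynomial.evalRingHom 0).comp φ.toRingHom
  have hψ : ∀ a ∈ P, ψ a = 0 := by
    intro a ha
    have : φ a = 0 := hPle ha
    change Polynomial.eval 0 (φ a) = 0
    rw [this]; simp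
  have hsurj : Function.Surjective (Ideal.Quotient.lift P ψ hψ) := by
    apply Ideal.Quotient.lift_surjective_of_surjective
    intro p
    refine ⟨rename Sum.inl p, ?_⟩
    change Polynomial.eval 0 (φ (rename Sum.inl p)) = p
    have : φ (rename Sum.inl p) = Polynomial.C p := by
      simp only [φ, aeval_rename]
      induction p using MvPolynomial.induction_on with
      | C c => simp [Polynomial.algebraMap_def, MvPolynomial.algebraMap_eq]
      | add p q hp hq => simp only [map_add, hp, hq]
      | mul_X p j hp => simp only [map_mul, hp, aeval_X]; rfl
    rw [this]; simp
  have hne : Ideal.Quotient.mk P (X (Sum.inr ⟨0, hn⟩)) ≠ 0 := by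
    rw [Ne, Ideal.Quotient.eq_zero_iff_mem]
    intro h
    have : φ (X (Sum.inr ⟨0, hn⟩)) = 0 := hPle h
    simp [φ] at this
  have := ringKrullDim_succ_le_of_surjective _ hsurj (mem_nonZeroDivisors_of_ne_zero hne)
    (by simp [ψ, φ])
  rw [MvPolynomial.ringKrullDim_of_isNoetherianRing, ringKrullDim_eq_zero_of_field] at this
  simpa using this

theorem aux_notmem (K : Type*) [Field K] (m : ℕ) :
    ∃ Q ∈ (binomialEdgeIdeal K (SimpleGraph.cycleGraph (m+4))).minimalPrimes,
      edgeBinomial K (1 : Fin (m+4)) 3 ∉ Q := by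
  let φ : MvPolynomial (Fin (m+4) ⊕ Fin (m+4)) K →ₐ[K] K :=
    aeval (Sum.elim (fun i => if i = 1 then 1 else 0) (fun i => if i = 3 then 1 else 0))
  have h13 : (1 : Fin (m+4)) ≠ 3 := by
    intro h
    have := congrArg Fin.val h
    simp [Fin.val_ofNat, Nat.mod_eq_of_lt (show 3 < m + 4 by omega)] at this
  have hn1 : ¬ (SimpleGraph.cycleGraph (m+4)).Adj 1 3 := by
    rw [SimpleGraph.cycleGraph_adj']
    have h3 : ((3 : Fin (m+4)) : ℕ) = 3 :=
      Nat.mod_eq_of_lt (show 3 < m + 4 by omega)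
    have h1 : ((1 : Fin (m+4)) : ℕ) = 1 :=
      Nat.mod_eq_of_lt (show 1 < m + 4 by omega)
    rw [Fin.val_sub, Fin.val_sub, h3, h1]
    rw [Nat.mod_eq_of_lt (show m + 4 - 3 + 1 < m + 4 by omega)]
    rw [show m + 4 - 1 + 3 = (m + 4) + 2 by omega, Nat.add_mod_left, Nat.mod_eq_of_lt (by omega)]
    omega
  have hker : binomialEdgeIdeal K (SimpleGraph.cycleGraph (m+4)) ≤ RingHom.ker φ := by
    refine Ideal.span_le.2 ?_
    rintro p ⟨i, j, hij, -, rfl⟩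
    have e1 : ¬ (i = 1 ∧ j = 3) := by rintro ⟨rfl, rfl⟩; exact hn1 hij
    have e2 : ¬ (j = 1 ∧ i = 3) := by rintro ⟨rfl, rfl⟩; exact hn1 hij.symm
    simp only [SetLike.mem_coe, RingHom.mem_ker, edgeBinomial, φ, map_sub, map_mul, aeval_X,
      Sum.elim_inl, Sum.elim_inr, ite_zero_mul_ite_zero, if_neg e1, if_neg e2, sub_zero]
  have : (RingHom.ker φ).IsPrime := RingHom.ker_isPrime _
  obtain ⟨P, hP, hPle⟩ := Ideal.exists_minimalPrimes_le hker
  refine ⟨P, hP, fun h => ?_⟩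
  have : φ (edgeBinomial K (1 : Fin (m+4)) 3) = 0 := hPle h
  simp [edgeBinomial, φ, h13, h13.symm] at this

theorem aux_not_unmixed (K : Type*) [Field K] (m : ℕ) :
    ¬ IsUnmixed (binomialEdgeIdeal K (SimpleGraph.cycleGraph (m+4))) := by
  intro hU
  obtain ⟨P, hP, hPd⟩ := aux_lower K (n := m+4) (by omega) (SimpleGraph.cycleGraph (m+4))
  obtain ⟨Q, hQ, hQn⟩ := aux_notmem K m
  have hQp : Q.IsPrime := hQ.1.1
  have e12 : edgeBinomial K (1 : Fin (m+4)) 2 ∈ Q := by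
    have := hQ.1.2 (aux_mem_J K _ _ _ (aux_adj (1 : Fin (m+4))))
    have e : (1 : Fin (m+4)) + 1 = 2 := by
      ext
      simp [Fin.val_add]
    rwa [e] at this
  have e23 : edgeBinomial K (2 : Fin (m+4)) 3 ∈ Q := by
    have := hQ.1.2 (aux_mem_J K _ _ _ (aux_adj (2 : Fin (m+4))))
    have e : (2 : Fin (m+4)) + 1 = 3 := by
      ext
      simp [Fin.val_add]
    rwa [e] at this
  have hx : X (Sum.inl (2 : Fin (m+4))) ∈ Q := by
    refine (hQp.mem_or_mem (x := X (Sum.inl (2 : Fin (m+4))))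
      (y := edgeBinomial K (1 : Fin (m+4)) 3) ?_).resolve_right hQn
    have := Q.add_mem (Q.mul_mem_left (X (Sum.inl 1)) e23) (Q.mul_mem_left (X (Sum.inl 3)) e12)
    convert this using 1
    unfold edgeBinomial; ring
  have hy : X (Sum.inr (2 : Fin (m+4))) ∈ Q := by
    refine (hQp.mem_or_mem (x := X (Sum.inr (2 : Fin (m+4))))
      (y := edgeBinomial K (1 : Fin (m+4)) 3) ?_).resolve_right hQn
    have := Q.add_mem (Q.mul_mem_left (X (Sum.inr 1)) e23) (Q.mul_mem_left (X (Sum.inr 3)) e12)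
    convert this using 1
    unfold edgeBinomial; ring
  have h1 := aux_upper K Q hQ.1.2 2 hx hy
  rw [hU Q hQ P hP] at h1
  have h2 : ((m + 4 + 1 : ℕ) : WithBot ℕ∞) ≤ ((m + 4 : ℕ) : WithBot ℕ∞) := hPd.trans h1
  have h3 : m + 4 + 1 ≤ m + 4 := by exact_mod_cast h2
  omega

theorem aux_comp (m : ℕ) (S : Finset (Fin (m+4))) (hS : S.Nonempty) :
    numComponents (SimpleGraph.cycleGraph (m+4)) S ≤ S.card := by
  classical
  unfold numComponents
  set H := (SimpleGraph.cycleGraph (m+4)).induce ((S : Set (Fin (m+4)))ᶜ) with hH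
  by_cases hne : Nonempty H.ConnectedComponent
  swap
  · rw [not_nonempty_iff] at hne
    simp
  obtain ⟨c0⟩ := hne
  let f : S → H.ConnectedComponent := fun s =>
    if h : s.1 + 1 ∈ S then c0 else H.connectedComponentMk ⟨s.1 + 1, by simpa using h⟩
  obtain ⟨s0, hs0⟩ := hS
  have key : ∀ k : ℕ, ∀ v : Fin (m+4), (hv : v ∉ S) → v - Fin.ofNat (m+4) k ∈ S →
      ∃ s, f s = H.connectedComponentMk ⟨v, by simpa using hv⟩ := by
    intro k
    induction k with
    | zero => intro v hv h; exact absurd (by simpa using h) hv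
    | succ k ih =>
      intro v hv h
      by_cases hv1 : v - 1 ∈ S
      · refine ⟨⟨v - 1, hv1⟩, ?_⟩
        simp only [f, sub_add_cancel, hv, dif_neg, not_false_eq_true]
      · have e : v - Fin.ofNat (m+4) (k+1) = v - 1 - Fin.ofNat (m+4) k := by
          have : Fin.ofNat (m+4) (k+1) = Fin.ofNat (m+4) k + 1 := by
            ext; simp [Fin.val_add]
          rw [this]; abel
        obtain ⟨s, hs⟩ := ih (v - 1) hv1 (e ▸ h)
        refine ⟨s, hs.trans ?_⟩
        apply SimpleGraph.ConnectedComponent.sound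
        apply SimpleGraph.Adj.reachable
        have := aux_adj (v - 1)
        rw [sub_add_cancel] at this
        exact this
  have hsurj : Function.Surjective f := by
    intro c
    induction c using SimpleGraph.ConnectedComponent.ind with
    | h v =>
      obtain ⟨v, hv⟩ := v
      exact key (v - s0).val v (by simpa using hv) (by simpa using hs0)
  have := Nat.card_le_card_of_surjective f hsurj
  simpa using this

theorem aux_empty (m : ℕ) : numComponents (SimpleGraph.cycleGraph (m+4)) ∅ = 1 := by
  unfold numComponents
  rw [Finset.coe_empty, Set.compl_empty,
    Nat.card_congr (SimpleGraph.induceUnivIso _).connectedComponentEquiv, Nat.card_eq_one_iff_unique]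
  have h : (SimpleGraph.cycleGraph (m+4)).Connected := SimpleGraph.cycleGraph_connected
  exact ⟨h.preconnected.subsingleton_connectedComponent, ⟨SimpleGraph.connectedComponentMk _ 0⟩⟩

/-- For the cycle `G` of length `n ≥ 4`: every nonempty `S ⊆ [n]` satisfies
`(n - |S|) + c(S) ≤ n`, while `(n - |∅|) + c(∅) = n + 1`; consequently `J_G` is not
unmixed. -/
theorem cycleGraph_not_unmixed (K : Type*) [Field K] {n : ℕ} (hn : 4 ≤ n) :
    (∀ S : Finset (Fin n), S.Nonempty →
        (n - S.card) + numComponents (SimpleGraph.cycleGraph n) S ≤ n) ∧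
      (n - (∅ : Finset (Fin n)).card) +
          numComponents (SimpleGraph.cycleGraph n) ∅ = n + 1 ∧
      ¬ IsUnmixed (binomialEdgeIdeal K (SimpleGraph.cycleGraph n)) := by
  obtain ⟨m, rfl⟩ : ∃ m, n = m + 4 := ⟨n - 4, by omega⟩
  refine ⟨?_, ?_, aux_not_unmixed K m⟩
  · intro S hS
    have h1 := aux_comp m S hS
    have h2 : S.card ≤ m + 4 := by simpa using S.card_le_univ
    omega
  · rw [aux_empty]; simp
end
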